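/- Contiguity difference relations for the normalized q-Racah polynomials: for each choice of sign σ ∈ {+,−} and all integers n, x with 0 ≤ n ≤ N and 0 ≤ x ≤ N, one has λ_σ(n;c₃,c₂,c₁;N)·p_n(x;c₁,c₂,c₃;N) = Σ_{ε∈{−1,0,+1}} Φ_σ^{ε}(x;c₃,c₂,c₁;N)·p_n(x−ε;c₁,c₂,c₃;N+σ1), where the superscript ε of Φ_σ is +, 0, − according as ε = +1, 0, −1, and p evaluated at a negative argument x−ε = −1 is 0. -/

import Mathlib

noncomputable section
namespace qR

/-- q-Pochhammer symbol `(a;q)_k = ∏_{l<k} (1 - a qˡ)`. -/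
def poch (q a : ℂ) (k : ℕ) : ℂ := ∏ l ∈ Finset.range k, (1 - a * q ^ l)

/-- q-binomial coefficient, zero outside `0 ≤ n ≤ N`. -/
def binom (q : ℂ) (N n : ℤ) : ℂ :=
  if 0 ≤ n ∧ n ≤ N then poch q q N.toNat / (poch q q n.toNat * poch q q (N - n).toNat) else 0

/-- Normalisation `Ω(n;c1,c2,c3;N)`; `s` and `t2` are the chosen square roots of `q` and `c2`,
so that `(q c2)^(n - N/2) = (s t2)^(2n - N)`. -/
def Om (q s c1 c2 c3 t2 : ℂ) (N n : ℤ) : ℂ :=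
  binom q N n * (1 - c2 * c3 * q ^ (2 * n + 1)) * poch q (q * c2) n.toNat
      * poch q (c1 * c2 * c3 * q ^ (N + 2)) n.toNat * poch q (q * c1) (N - n).toNat
    / ((s * t2) ^ (2 * n - N) * poch q (c2 * c3 * q ^ (n + 1)) (N + 1).toNat
        * poch q (q * c3) n.toNat)

/-- Normalised q-Racah polynomial `p_n(x;c1,c2,c3;N)`, with the convention that it
vanishes unless `0 ≤ n ≤ N` and `0 ≤ x ≤ N`. -/
def p (q s c1 c2 c3 t2 : ℂ) (N n x : ℤ) : ℂ :=
  if 0 ≤ n ∧ n ≤ N ∧ 0 ≤ x ∧ x ≤ N then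
    Om q s c1 c2 c3 t2 N n *
      ∑ k ∈ Finset.range (n.toNat + 1),
        poch q (q ^ (-n)) k * poch q (c2 * c3 * q ^ (n + 1)) k * poch q (q ^ (-x)) k
            * poch q (c1 * c2 * q ^ (x + 1)) k * q ^ k
          / (poch q (q * c2) k * poch q (c1 * c2 * c3 * q ^ (N + 2)) k
              * poch q (q ^ (-N)) k * poch q q k)
  else 0

/-- `ω_n(c) = (-1)^n c^{n/2} q^{n(n+1)/2}`, where `r` is the chosen square root of `c`. -/
def om (q r : ℂ) (n : ℤ) : ℂ := (-1 : ℂ) ^ n * r ^ n * q ^ (n * (n + 1) / 2)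

/-- `ξ_n(c1,c2) = ((qc1;q)_n/(qc2;q)_n) (c2/c1)^{n/2}`, where `t1, t2` are the chosen
square roots of `c1, c2`. -/
def xi (q c1 c2 t1 t2 : ℂ) (n : ℤ) : ℂ :=
  poch q (q * c1) n.toNat / poch q (q * c2) n.toNat * (t2 / t1) ^ n

/-- `λ(x;c) = -(1-q^{-x})(1-c q^{x+1})`. -/
def lam (q c : ℂ) (x : ℤ) : ℂ := -(1 - q ^ (-x)) * (1 - c * q ^ (x + 1))

def PhiP (q c1 c2 c3 : ℂ) (N n : ℤ) : ℂ :=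
  -c2 * q ^ (n - N) * (1 - q ^ n) * (1 - c1 * q ^ (N - n + 1)) * (1 - c2 * c3 * q ^ (n + N + 1))
      * (1 - c3 * q ^ n)
    / ((1 - c2 * c3 * q ^ (2 * n)) * (1 - c2 * c3 * q ^ (2 * n + 1)))

def PhiM (q c1 c2 c3 : ℂ) (N n : ℤ) : ℂ :=
  (1 - q ^ (n - N)) * (1 - c1 * c2 * c3 * q ^ (n + N + 2)) * (1 - c2 * q ^ (n + 1))
      * (1 - c2 * c3 * q ^ (n + 1))
    / ((1 - c2 * c3 * q ^ (2 * n + 1)) * (1 - c2 * c3 * q ^ (2 * n + 2)))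

/-- `Φ^ε(n;c1,c2,c3;N)`, where `ε = 1, -1, 0` selects `Φ⁺, Φ⁻, Φ⁰`. -/
def Phi (q c1 c2 c3 : ℂ) (N ε n : ℤ) : ℂ :=
  if ε = 1 then PhiP q c1 c2 c3 N n
  else if ε = -1 then PhiM q c1 c2 c3 N n
  else -PhiP q c1 c2 c3 N n - PhiM q c1 c2 c3 N n

/-- `λ₊(x;c1,c2,c3;N)`. -/
def lamP (q c1 c2 c3 : ℂ) (N x : ℤ) : ℂ :=
  -(q ^ (-N - 1) / c3 - q ^ (-x)) * (1 - c1 * c2 * c3 * q ^ (N + x + 2))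

/-- `λ₋(x;c1,c2,c3;N)`. -/
def lamM (q c1 c2 c3 : ℂ) (N x : ℤ) : ℂ :=
  -(q ^ (-N) - q ^ (-x)) * (1 - c1 * c2 * q ^ (N + x + 1))

def PhiPp (q sq c1 c2 c3 : ℂ) (N n : ℤ) : ℂ :=
  -sq * c2 * q ^ (2 * n - N - 1) * (1 - q ^ n) * (1 - c1 * q ^ (N - n + 1))
      * (1 - c1 * q ^ (N + 2 - n)) * (1 - c3 * q ^ n)
    / ((1 - c2 * c3 * q ^ (2 * n)) * (1 - c2 * c3 * q ^ (2 * n + 1)))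

def PhiPm (q sq c1 c2 c3 : ℂ) (N n : ℤ) : ℂ :=
  -((1 - c1 * c2 * c3 * q ^ (n + N + 2)) * (1 - c1 * c2 * c3 * q ^ (n + N + 3))
      * (1 - c2 * q ^ (n + 1)) * (1 - c2 * c3 * q ^ (n + 1)))
    / (c3 * q ^ (N + 1) * sq * (1 - c2 * c3 * q ^ (2 * n + 1)) * (1 - c2 * c3 * q ^ (2 * n + 2)))

def PhiP0 (q sq c1 c2 c3 : ℂ) (N n : ℤ) : ℂ :=
  -PhiPp q sq c1 c2 c3 N n - PhiPm q sq c1 c2 c3 N n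
    - (1 - c1 * c2 * q ^ (N + 2)) * (1 - c1 * c2 * c3 * q ^ (N + 2)) / (c3 * q ^ (N + 1) * sq)

def PhiMp (q sq c1 c2 c3 : ℂ) (N n : ℤ) : ℂ :=
  -sq * (1 - q ^ n) * (1 - c3 * q ^ n) * (1 - c2 * c3 * q ^ (n + N))
      * (1 - c2 * c3 * q ^ (n + N + 1))
    / (q ^ N * (1 - c2 * c3 * q ^ (2 * n)) * (1 - c2 * c3 * q ^ (2 * n + 1)))

def PhiMm (q sq c1 c2 c3 : ℂ) (N n : ℤ) : ℂ :=
  -c3 * sq * q ^ N * (1 - q ^ (n - N)) * (1 - q ^ (n - N + 1)) * (1 - c2 * q ^ (n + 1))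
      * (1 - c2 * c3 * q ^ (n + 1))
    / ((1 - c2 * c3 * q ^ (2 * n + 1)) * (1 - c2 * c3 * q ^ (2 * n + 2)))

def PhiM0 (q sq c1 c2 c3 : ℂ) (N n : ℤ) : ℂ :=
  -PhiMp q sq c1 c2 c3 N n - PhiMm q sq c1 c2 c3 N n - sq * (1 - c3 * q ^ N) * (q ^ (-N) - 1)

/-- Contiguity coefficient `Φ_σ^ε(n;c1,c2,c3;N)`, where `σ = 1` is the `+` and `σ = -1`
the `-` family, `ε ∈ {1,0,-1}` selects the superscript, and `sq` is the chosen square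
root of `q c2`. -/
def PhiC (q sq c1 c2 c3 : ℂ) (σ ε N n : ℤ) : ℂ :=
  if σ = 1 then
    if ε = 1 then PhiPp q sq c1 c2 c3 N n
    else if ε = -1 then PhiPm q sq c1 c2 c3 N n
    else PhiP0 q sq c1 c2 c3 N n
  else
    if ε = 1 then PhiMp q sq c1 c2 c3 N n
    else if ε = -1 then PhiMm q sq c1 c2 c3 N n
    else PhiM0 q sq c1 c2 c3 N n

def Fp (q c1 c2 : ℂ) (x : ℤ) : ℂ :=
  c1 * c2 ^ 2 * q ^ (x + 1) * (1 - c1 * q ^ x) * (1 - q ^ x)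
    / ((1 - c1 * c2 * q ^ (2 * x)) * (1 - c1 * c2 * q ^ (2 * x + 1)))

def Fm (q c1 c2 : ℂ) (x : ℤ) : ℂ :=
  c1 * c2 * q ^ (x + 1) * (1 - c2 * q ^ (x + 1)) * (1 - c1 * c2 * q ^ (x + 1))
    / ((1 - c1 * c2 * q ^ (2 * x + 1)) * (1 - c1 * c2 * q ^ (2 * x + 2)))

/-- The coefficients `A^{ε,ε'}_{i,j}(c1,c2,c3,c4;N)` for `(ε,ε') ≠ (0,0)`;
`t2` is the chosen square root of `c2` and the fifth parameter
`c0 = (q^{2N+3} c1 c2 c3 c4)⁻¹` is computed internally. -/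
def Aaux (q s c1 c2 c3 c4 t2 : ℂ) (N ε ε' i j : ℤ) : ℂ :=
  if ε' = 1 ∨ ε' = -1 then
    -c3 * q ^ (N + 1) *
        (if ε' = 1 then Fp q c4 ((q ^ (2 * N + 3) * c1 * c2 * c3 * c4)⁻¹) j
         else Fm q c4 ((q ^ (2 * N + 3) * c1 * c2 * c3 * c4)⁻¹) j) *
        PhiC q (s * t2) c1 c2 c3 ε' ε (N - j) i
  else if ε = 1 ∨ ε = -1 then
    c3 * q ^ (N + 1) *
        (Fp q c4 ((q ^ (2 * N + 3) * c1 * c2 * c3 * c4)⁻¹) j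
          + Fm q c4 ((q ^ (2 * N + 3) * c1 * c2 * c3 * c4)⁻¹) j) *
        Phi q c1 c2 c3 (N - j) ε i
  else 0

/-- The coefficients `A^{ε,ε'}_{i,j}(c1,c2,c3,c4;N)`. -/
def A (q s c1 c2 c3 c4 t2 : ℂ) (N ε ε' i j : ℤ) : ℂ :=
  if ε = 0 ∧ ε' = 0 then
    -((1 - c3 * q ^ (N + 1 - j)) * (s * t2) / (1 - c1 * c2 * q ^ (N + 2 - j)))
          * ∑ e ∈ ({-1, 0, 1} : Finset ℤ), Aaux q s c1 c2 c3 c4 t2 N e 1 i j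
      - (1 - c1 * c2 * q ^ (N + 1 - j)) / ((1 - c3 * q ^ (N - j)) * (s * t2))
          * ∑ e ∈ ({-1, 0, 1} : Finset ℤ), Aaux q s c1 c2 c3 c4 t2 N e (-1) i j
      - ∑ e ∈ ({-1, 1} : Finset ℤ), Aaux q s c1 c2 c3 c4 t2 N e 0 i j
  else Aaux q s c1 c2 c3 c4 t2 N ε ε' i j

/-- `Λ(x;c1,c2,c3,c4;N)`; `s, t1, t2, t3, t4` are the chosen square roots of
`q, c1, c2, c3, c4`. -/
def Lam (q s c1 c2 c3 c4 t1 t2 t3 t4 : ℂ) (N x : ℤ) : ℂ :=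
  (-1 : ℂ) ^ x * binom q N x * (1 - c1 * c2 * q ^ (2 * x + 1)) * poch q (q * c2) x.toNat
      * (s * t2) ^ N * (t1 * t3 / (t2 * t4)) ^ x * q ^ (x * (x - 1) / 2)
    / (poch q (q * c1) x.toNat * poch q (q ^ (x + 1) * c1 * c2) (N + 1).toNat)

/-- Tratnik polynomial of q-Racah type `T_{i,j}(x,y;c1,c2,c3,c4;N)`; the fifth parameter
`c0 = (q^{2N+3} c1 c2 c3 c4)⁻¹` and its square root `t0 = (s^{2N+3} t1 t2 t3 t4)⁻¹`
are computed internally. -/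
def T (q s c1 c2 c3 c4 t1 t2 t3 t4 : ℂ) (N i j x y : ℤ) : ℂ :=
  if 0 ≤ i ∧ 0 ≤ j ∧ i + j ≤ N then
    p q s c1 c2 c3 t2 (N - j) i x *
      p q s c3 ((q ^ (2 * N + 3) * c1 * c2 * c3 * c4)⁻¹) c4
        ((s ^ (2 * N + 3) * t1 * t2 * t3 * t4)⁻¹) (N - x) j y
  else 0

/-- Griffiths polynomial of q-Racah type `G_{i,j}(x,y;c1,c2,c3,c4;N)`; the fifth parameter
`c0 = (q^{2N+3} c1 c2 c3 c4)⁻¹` and its square root `t0 = (s^{2N+3} t1 t2 t3 t4)⁻¹`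
are computed internally. -/
def G (q s c1 c2 c3 c4 t1 t2 t3 t4 : ℂ) (N i j x y : ℤ) : ℂ :=
  if 0 ≤ i ∧ 0 ≤ j ∧ i + j ≤ N then
    ∑ a ∈ Finset.range ((min (N - j) (N - y)).toNat + 1),
      om q (t1 * t2 * t3 / t4) (a : ℤ) * p q s c1 c2 c3 t2 (N - j) i (a : ℤ) *
        p q s c3 ((q ^ (2 * N + 3) * c1 * c2 * c3 * c4)⁻¹) c4
          ((s ^ (2 * N + 3) * t1 * t2 * t3 * t4)⁻¹) (N - (a : ℤ)) j y *
        p q s c4 c2 c1 t2 (N - y) (a : ℤ) x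
  else 0

end qR
namespace qR

lemma poch_succ (q a : ℂ) (k : ℕ) : poch q a (k+1) = poch q a k * (1 - a * q^k) := by
  simp [poch, Finset.prod_range_succ]

lemma poch_shift (q a : ℂ) (k : ℕ) : (1 - a) * poch q (q*a) k = poch q a k * (1 - a*q^k) := by
  rw [← poch_succ]
  simp only [poch]
  rw [Finset.prod_range_succ' (fun l => 1 - a * q ^ l)]
  rw [mul_comm]
  congr 1
  · apply Finset.prod_congr rfl; intro l _; ring
  · simp

lemma poch_ne (q a : ℂ) (k : ℕ) (h : ∀ l, l < k → 1 - a * q^l ≠ 0) : poch q a k ≠ 0 := by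
  rw [poch, Finset.prod_ne_zero_iff]
  intro l hl
  exact h l (Finset.mem_range.mp hl)

/-- basis function, with `X = q^x`, `c = c1 c2` -/
def FF (q c X : ℂ) (k : ℕ) : ℂ := poch q X⁻¹ k * poch q (c*q*X) k

lemma FF_zero (q c X : ℂ) : FF q c X 0 = 1 := by simp [FF, poch]

lemma FF_one (q c X : ℂ) (k : ℕ) :
    FF q c X (k+1) = FF q c X k * ((1 - q^k/X) * (1 - c*q*X*q^k)) := by
  simp only [FF, poch_succ]; ring

lemma FF_up (q c X : ℂ) (hq : q ≠ 0) (hX : X ≠ 0) (k : ℕ) :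
    (1 - c*q*X) * FF q c (q*X) (k+1)
      = FF q c X k * ((1 - c*q*X*q^k) * (1 - 1/(q*X)) * (1 - c*X*q^k*q^2)) := by
  have h1 := poch_shift q (q*X)⁻¹ k
  have h2 := poch_shift q (c*q*X) (k+1)
  have e1 : q * (q*X)⁻¹ = X⁻¹ := by field_simp
  have e2 : q * (c*q*X) = c*q*(q*X) := by ring
  rw [e1, ← poch_succ] at h1
  rw [e2, poch_succ q (c*q*X)] at h2
  simp only [FF]
  calc _ = poch q (q*X)⁻¹ (k+1) * ((1 - c*q*X) * poch q (c*q*(q*X)) (k+1)) := by ring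
    _ = _ := by rw [← h1, h2]; ring

lemma FF_down (q c X : ℂ) (hq : q ≠ 0) (hX : X ≠ 0) (k : ℕ) :
    (1 - 1/X) * FF q c (X/q) (k+1)
      = FF q c X k * ((1 - q^k/X) * (1 - q^k*q/X) * (1 - c*X)) := by
  have h1 := poch_shift q X⁻¹ (k+1)
  have h2 := poch_shift q (c*X) k
  have e1 : q * X⁻¹ = (X/q)⁻¹ := by field_simp
  have e2 : q * (c*X) = c*q*X := by ring
  have e3 : c*q*(X/q) = c*X := by field_simp
  rw [e1, poch_succ q X⁻¹] at h1
  rw [e2, ← poch_succ] at h2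
  simp only [FF, e3]
  calc _ = ((1 - X⁻¹) * poch q (X/q)⁻¹ (k+1)) * poch q (c*X) (k+1) := by ring
    _ = _ := by rw [h1, ← h2]; ring

/-- plus operator -/
lemma op_plus (q S c1 c2 c3 M X : ℂ) (hq : q ≠ 0) (hX : X ≠ 0) (hM : M ≠ 0) (hS : S ≠ 0)
    (hSS : S^2 = q*c2) (hc1 : c1 ≠ 0) (hc2 : c2 ≠ 0)
    (h0 : 1 - c2*c1*X^2 ≠ 0) (h1 : 1 - c2*c1*X^2*q ≠ 0) (h2 : 1 - c2*c1*X^2*q^2 ≠ 0)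
    (Pp P0 Pm : ℂ)
    (hPp : Pp = -S*c2*(X^2/M/q)*(1-X)*(1-c3*(M*q/X))*(1-c3*(M*q^2/X))*(1-c1*X)
      /((1 - c2*c1*X^2)*(1 - c2*c1*X^2*q)))
    (hPm : Pm = -((1-c3*c2*c1*(X*M*q^2))*(1-c3*c2*c1*(X*M*q^3))*(1-c2*(X*q))*(1-c2*c1*(X*q)))
      /(c1*(M*q)*S*(1 - c2*c1*X^2*q)*(1 - c2*c1*X^2*q^2)))
    (hP0 : P0 = -Pp - Pm - (1-c3*c2*(M*q^2))*(1-c3*c2*c1*(M*q^2))/(c1*(M*q)*S)) (k : ℕ) :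
    Pm * FF q (c1*c2) (q*X) (k+1) + P0 * FF q (c1*c2) X (k+1) + Pp * FF q (c1*c2) (X/q) (k+1)
      = -(1-c2*c3*(q^(k+1))*M*q^2)*(1-c1*c2*c3*M*q^(k+1)*q^2)/(c1*M*q*S*q^(k+1))
          * FF q (c1*c2) X (k+1)
        + -(1-1/q^(k+1))*(1-c1*c2*c3*q^(k+1)*M*q)*(1-c1*c2*c3*q^(k+1)*M*q^2)*(1-c2*q^(k+1))
          /(c1*M*q*S) * FF q (c1*c2) X k := by
  have hu := FF_up q (c1*c2) X hq hX k
  have hd := FF_down q (c1*c2) X hq hX k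
  have hSi : S⁻¹ = S/(q*c2) := by rw [← hSS]; field_simp
  obtain ⟨Pm', hPm'⟩ : ∃ y, y = -((1-c3*c2*c1*(X*M*q^2))*(1-c3*c2*c1*(X*M*q^3))*(1-c2*(X*q)))
      /(c1*(M*q)*(1 - c2*c1*X^2*q)*(1 - c2*c1*X^2*q^2))*S⁻¹ := ⟨_, rfl⟩
  obtain ⟨Pp', hPp'⟩ : ∃ y, y = S*c2*(X^3/M/q)*(1-c3*(M*q/X))*(1-c3*(M*q^2/X))*(1-c1*X)
      /((1 - c2*c1*X^2)*(1 - c2*c1*X^2*q)) := ⟨_, rfl⟩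
  have e1 : Pm = Pm' * (1 - c1*c2*q*X) := by rw [hPm, hPm']; field_simp
  have e2 : Pp = Pp' * (1 - 1/X) := by rw [hPp, hPp']; field_simp; ring
  have e3 : Pm * FF q (c1*c2) (q*X) (k+1) = Pm' * (FF q (c1*c2) X k * ((1 - c1*c2*q*X*q^k) * (1 - 1/(q*X)) * (1 - c1*c2*X*q^k*q^2))) := by
    rw [← hu, e1]; ring
  have e4 : Pp * FF q (c1*c2) (X/q) (k+1) = Pp' * (FF q (c1*c2) X k * ((1 - q^k/X) * (1 - q^k*q/X) * (1 - c1*c2*X))) := by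
    rw [← hd, e2]; ring
  rw [e3, e4, FF_one, hP0, e1, e2]
  have hK : q^k ≠ 0 := pow_ne_zero _ hq
  rw [pow_succ q k]
  generalize q^k = K at *
  generalize FF q (c1*c2) X k = G
  have key : Pm' * ((1 - c1*c2*q*X*K) * (1 - 1/(q*X)) * (1 - c1*c2*X*K*q^2))
     + (-(Pp' * (1 - 1/X)) - Pm' * (1 - c1*c2*q*X) - (1-c3*c2*(M*q^2))*(1-c3*c2*c1*(M*q^2))/(c1*(M*q)) * S⁻¹)
        * ((1 - K/X) * (1 - c1*c2*q*X*K))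
     + Pp' * ((1 - K/X) * (1 - K*q/X) * (1 - c1*c2*X))
     = -(1-c2*c3*(K*q)*M*q^2)*(1-c1*c2*c3*M*(K*q)*q^2)/(c1*M*q*(K*q)) * S⁻¹
          * ((1 - K/X) * (1 - c1*c2*q*X*K))
        + -(1-1/(K*q))*(1-c1*c2*c3*(K*q)*M*q)*(1-c1*c2*c3*(K*q)*M*q^2)*(1-c2*(K*q))
          /(c1*M*q) * S⁻¹ := by
    rw [hPm', hPp', hSi]
    clear hSi e1 e2 e3 e4 hu hd hPm hPp hP0 hPm' hPp'
    field_simp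
    ring
  simp only [div_eq_mul_inv, mul_inv] at key ⊢
  linear_combination G * key

/-- minus operator -/
lemma op_minus (q S c1 c2 M X : ℂ) (hq : q ≠ 0) (hX : X ≠ 0) (hM : M ≠ 0)
    (h0 : 1 - c2*c1*X^2 ≠ 0) (h1 : 1 - c2*c1*X^2*q ≠ 0) (h2 : 1 - c2*c1*X^2*q^2 ≠ 0)
    (Pp P0 Pm : ℂ)
    (hPp : Pp = -S*(1-X)*(1-c1*X)*(1-c2*c1*(X*M))*(1-c2*c1*(X*M*q))
      /(M*(1 - c2*c1*X^2)*(1 - c2*c1*X^2*q)))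
    (hPm : Pm = -c1*S*M*(1-X/M)*(1-X*q/M)*(1-c2*(X*q))*(1-c2*c1*(X*q))
      /((1 - c2*c1*X^2*q)*(1 - c2*c1*X^2*q^2)))
    (hP0 : P0 = -Pp - Pm - S*(1-c1*M)*(1/M-1)) (k : ℕ) :
    Pm * FF q (c1*c2) (q*X) (k+1) + P0 * FF q (c1*c2) X (k+1) + Pp * FF q (c1*c2) (X/q) (k+1)
      = S*(1-c1*M/q^(k+1))*(1-q^(k+1)/M) * FF q (c1*c2) X (k+1)
        + -c1*S*M*(1-q^k/M)*(1-q^(k+1)/M)*(1-c2*q^(k+1))*(1-1/q^(k+1)) * FF q (c1*c2) X k := by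
  have hu := FF_up q (c1*c2) X hq hX k
  have hd := FF_down q (c1*c2) X hq hX k
  obtain ⟨Pm', hPm'⟩ : ∃ y, y = -c1*S*M*(1-X/M)*(1-X*q/M)*(1-c2*(X*q))
      /((1 - c2*c1*X^2*q)*(1 - c2*c1*X^2*q^2)) := ⟨_, rfl⟩
  obtain ⟨Pp', hPp'⟩ : ∃ y, y = S*X*(1-c1*X)*(1-c2*c1*(X*M))*(1-c2*c1*(X*M*q))
      /(M*(1 - c2*c1*X^2)*(1 - c2*c1*X^2*q)) := ⟨_, rfl⟩
  have e1 : Pm = Pm' * (1 - c1*c2*q*X) := by rw [hPm, hPm']; field_simp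
  have e2 : Pp = Pp' * (1 - 1/X) := by rw [hPp, hPp']; field_simp; ring
  have e3 : Pm * FF q (c1*c2) (q*X) (k+1) = Pm' * (FF q (c1*c2) X k * ((1 - c1*c2*q*X*q^k) * (1 - 1/(q*X)) * (1 - c1*c2*X*q^k*q^2))) := by
    rw [← hu, e1]; ring
  have e4 : Pp * FF q (c1*c2) (X/q) (k+1) = Pp' * (FF q (c1*c2) X k * ((1 - q^k/X) * (1 - q^k*q/X) * (1 - c1*c2*X))) := by
    rw [← hd, e2]; ring
  rw [e3, e4, FF_one, hP0, e1, e2]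
  have hK : q^k ≠ 0 := pow_ne_zero _ hq
  rw [pow_succ q k]
  generalize q^k = K at *
  generalize FF q (c1*c2) X k = G
  have key : Pm' * ((1 - c1*c2*q*X*K) * (1 - 1/(q*X)) * (1 - c1*c2*X*K*q^2))
     + (-(Pp' * (1 - 1/X)) - Pm' * (1 - c1*c2*q*X) - S*(1-c1*M)*(1/M-1))
        * ((1 - K/X) * (1 - c1*c2*q*X*K))
     + Pp' * ((1 - K/X) * (1 - K*q/X) * (1 - c1*c2*X))
     = S*(1-c1*M/(K*q))*(1-K*q/M)
          * ((1 - K/X) * (1 - c1*c2*q*X*K))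
        + -c1*S*M*(1-K/M)*(1-K*q/M)*(1-c2*(K*q))*(1-1/(K*q)) := by
    rw [hPm', hPp']
    clear e1 e2 e3 e4 hu hd hPm hPp hP0 hPm' hPp'
    have i1 : (1 - K/M) = (M-K)/M := by field_simp
    have i2 : (1 - X*q/M) = (M-X*q)/M := by field_simp
    have i3 : (1 - X/M) = (M-X)/M := by field_simp
    have i4 : (1 - K*q/M) = (M-K*q)/M := by field_simp
    rw [i1, i2, i3, i4]
    clear i1 i2 i3 i4
    obtain ⟨D0, hD0⟩ : ∃ y, y = 1 - c2*c1*X^2 := ⟨_, rfl⟩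
    obtain ⟨D1, hD1⟩ : ∃ y, y = 1 - c2*c1*X^2*q := ⟨_, rfl⟩
    obtain ⟨D2, hD2⟩ : ∃ y, y = 1 - c2*c1*X^2*q^2 := ⟨_, rfl⟩
    rw [← hD0] at h0 ⊢
    rw [← hD1] at h1 ⊢
    rw [← hD2] at h2 ⊢
    field_simp
    rw [hD0, hD1, hD2]
    ring
  linear_combination G * key

lemma sum_abs (w v A B r F D : ℕ → ℂ) (R : ℂ) (n : ℕ)
    (hD0 : D 0 = A 0 * F 0) (hD : ∀ k, D (k+1) = A (k+1) * F (k+1) + B (k+1) * F k)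
    (hr : ∀ k, k < n → w (k+1) * B (k+1) = w k * r k) (hrn : r n = 0)
    (hv : ∀ k, k ≤ n → R * v k = w k * (A k + r k)) :
    ∑ k ∈ Finset.range (n+1), w k * D k = R * ∑ k ∈ Finset.range (n+1), v k * F k := by
  have H : ∀ m, m ≤ n → ∑ k ∈ Finset.range (m+1), w k * D k
      = R * ∑ k ∈ Finset.range (m+1), v k * F k - w m * r m * F m := by
    intro m
    induction m with
    | zero =>
      intro _
      have := hv 0 (Nat.zero_le _)
      simp [hD0]
      linear_combination -F 0 * this
    | succ m ih =>
      intro hm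
      rw [Finset.sum_range_succ, ih (by omega), Finset.sum_range_succ _ (m+1), hD]
      have := hv (m+1) hm
      have h2 := hr m (by omega)
      linear_combination -F (m+1) * this + F m * h2
  rw [H n le_rfl, hrn]; ring

/-- coefficients of the basic hypergeometric series -/
def wt (q a b d E V : ℂ) (k : ℕ) : ℂ :=
  poch q a k * poch q b k * q^k / (poch q d k * poch q E k * poch q V k * poch q q k)

lemma wt_succ (q a b d E V : ℂ) (k : ℕ) : wt q a b d E V (k+1)
    = wt q a b d E V k * ((1-a*q^k)*(1-b*q^k)*q/((1-d*q^k)*(1-E*q^k)*(1-V*q^k)*(1-q*q^k))) := by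
  simp only [wt, poch_succ, pow_succ, div_eq_mul_inv, mul_inv]
  ring

lemma wt_shift (q a b d E V : ℂ) (k : ℕ) (h1 : 1 - E ≠ 0) (h2 : 1 - V*q^k ≠ 0)
    (hE : poch q E k ≠ 0) (hE' : poch q (q*E) k ≠ 0) (hV : poch q V k ≠ 0)
    (hV' : poch q (q*V) k ≠ 0) :
    wt q a b d E (q*V) k * ((1-E)*(1-V*q^k)) = wt q a b d (q*E) V k * ((1-E*q^k)*(1-V)) := by
  have e1 := poch_shift q E k
  have e2 := poch_shift q V k
  have e3 : (1 - E) * (1-V*q^k) * (poch q (q*E) k * poch q V k) =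
     (1-E*q^k) * (1-V) * (poch q E k * poch q (q*V) k) := by
    linear_combination (1-V*q^k)* poch q V k * e1 - (1-E*q^k) * poch q E k * e2
  have e4 : (1 - E) * (1-V*q^k) * ((poch q E k)⁻¹ * (poch q (q*V) k)⁻¹) =
     (1-E*q^k) * (1-V) * ((poch q (q*E) k)⁻¹ * (poch q V k)⁻¹) := by
    generalize poch q (q*E) k = y1 at *
    generalize poch q (q*V) k = y2 at *
    field_simp
    linear_combination e3
  simp only [wt, div_eq_mul_inv, mul_inv]
  linear_combination (poch q a k * poch q b k * q ^ k * (poch q d k)⁻¹ * (poch q q k)⁻¹) * e4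

end qR
namespace qR

lemma coef_plus_v (q S c1 c2 c3 M P K E v w : ℂ) (hq : q ≠ 0) (hM : M ≠ 0) (hS : S ≠ 0)
    (hc1 : c1 ≠ 0) (hP : P ≠ 0) (hK : K ≠ 0) (hEd : E = c1*c2*c3*(M*q^2))
    (hE : 1 - E ≠ 0) (hVK : 1 - (q*M)⁻¹*K ≠ 0) (hMq : 1 - M*q ≠ 0)
    (h : v * ((1-E)*(1-(q*M)⁻¹*K)) = w * ((1-E*K)*(1-(q*M)⁻¹))) :
    -(1-E)*(1-M*q/P)*(1-c2*c3*P*M*q^2)/(c1*M*q*(1-M*q)*S) * v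
      = w * (-(1-c2*c3*K*M*q^2)*(1-c1*c2*c3*M*K*q^2)/(c1*M*q*S*K)
         + (1-K/P)*(1-c2*c3*P*q*K)*(1-E*K)/((1-(q*M)⁻¹*K)*K*c1*M*q*S)) := by
  have hv : v = w * ((1-E*K)*(1-(q*M)⁻¹)) / ((1-E)*(1-(q*M)⁻¹*K)) := by
    rw [eq_div_iff (mul_ne_zero hE hVK)]; exact h
  rw [hv]
  have e1 : 1-c1*c2*c3*M*K*q^2 = 1-E*K := by rw [hEd]; ring
  have e2 : 1 - (q*M)⁻¹ = (M*q-1)/(q*M) := by field_simp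
  have e3 : 1 - (q*M)⁻¹*K = (q*M-K)/(q*M) := by field_simp
  have e4 : M*q - 1 = -(1-M*q) := by ring
  rw [e1, e2, e4]
  rw [e3] at hVK ⊢
  have h5 : q*M - K ≠ 0 := by intro h; rw [h] at hVK; simp at hVK
  clear hv h e1 e2 e3 e4 hEd
  generalize hE1 : 1 - E = E1 at *
  generalize hD1 : 1 - M*q = D1 at *
  generalize 1 - E*K = E2 at *
  generalize hD2 : q*M - K = D2 at *
  field_simp
  rw [← hD2]
  ring

lemma coef_plus_r (q S c1 c2 c3 M P K E w : ℂ) (hq : q ≠ 0)  (hM : M ≠ 0) (hS : S ≠ 0)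
    (hc1 : c1 ≠ 0) (hP : P ≠ 0) (hK : K ≠ 0) (hEd : E = c1*c2*c3*(M*q^2))
    (h1 : 1 - q*c2*K ≠ 0) (h2 : 1 - q*E*K ≠ 0) (h3 : 1 - (q*M)⁻¹*K ≠ 0) (h4 : 1 - q*K ≠ 0) :
    w * ((1-P⁻¹*K)*(1-c2*c3*P*q*K)*q/((1-q*c2*K)*(1-q*E*K)*(1-(q*M)⁻¹*K)*(1-q*K)))
      * (-(1-1/(K*q))*(1-c1*c2*c3*(K*q)*M*q)*(1-c1*c2*c3*(K*q)*M*q^2)*(1-c2*(K*q))/(c1*M*q*S))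
      = w * ((1-K/P)*(1-c2*c3*P*q*K)*(1-E*K)/((1-(q*M)⁻¹*K)*K*c1*M*q*S)) := by
  have e1 : 1-c1*c2*c3*(K*q)*M*q = 1 - E*K := by rw [hEd]; ring
  have e2 : 1-c1*c2*c3*(K*q)*M*q^2 = 1 - q*E*K := by rw [hEd]; ring
  have e3 : 1-c2*(K*q) = 1 - q*c2*K := by ring
  have e4 : 1-1/(K*q) = -(1-q*K)/(K*q) := by field_simp; ring
  rw [e1, e2, e3, e4]
  clear e1 e2 e3 e4 hEd
  generalize 1 - q*c2*K = d1 at *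
  generalize 1 - q*E*K = d2 at *
  generalize 1 - (q*M)⁻¹*K = d3 at *
  generalize 1 - q*K = d4 at *
  field_simp

lemma coef_minus_v (q S c1 c2 c3 M P K E v w : ℂ) (hM : M ≠ 0)
    (hP : P ≠ 0) (hK : K ≠ 0) (hEd : E = c1*c2*c3*(M*q))
    (hE : 1 - E ≠ 0) (hEK : 1 - E*K ≠ 0) (hM1 : 1 - M ≠ 0)
    (h : w * ((1-E)*(1-M⁻¹*K)) = v * ((1-E*K)*(1-M⁻¹))) :
    -S*(1-M)*(1-E*P)*(1-c1*M/P)/(M*(1-E)) * v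
      = w * (S*(1-c1*M/K)*(1-K/M)
         + (1-K/P)*(1-c2*c3*P*q*K)*c1*S*M*(1-K/M)/((1-E*K)*K)) := by
  have h5 : 1 - M⁻¹ = -(1-M)/M := by field_simp; ring
  have h6 : 1 - M⁻¹ ≠ 0 := by rw [h5]; exact div_ne_zero (neg_ne_zero.mpr hM1) hM
  have hv : v = w * ((1-E)*(1-M⁻¹*K)) / ((1-E*K)*(1-M⁻¹)) := by
    rw [eq_div_iff (mul_ne_zero hEK h6)]; exact h.symm
  rw [hv, h5]
  have e3 : 1 - M⁻¹*K = (M-K)/M := by field_simp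
  have e4 : 1 - K/M = (M-K)/M := by field_simp
  rw [e3, e4]
  clear hv h h5 h6 e3 e4
  generalize hE1 : 1 - E = E1 at *
  generalize hD1 : 1 - M = D1 at *
  generalize hE2 : 1 - E*K = E2 at *
  field_simp
  rw [← hE2, hEd]
  ring

lemma coef_minus_r (q S c1 c2 c3 M P K E w : ℂ) (hq : q ≠ 0)  (hM : M ≠ 0)
    (hK : K ≠ 0)
    (h1 : 1 - q*c2*K ≠ 0) (h2 : 1 - E*K ≠ 0) (h3 : 1 - q*M⁻¹*K ≠ 0) (h4 : 1 - q*K ≠ 0) :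
    w * ((1-P⁻¹*K)*(1-c2*c3*P*q*K)*q/((1-q*c2*K)*(1-E*K)*(1-q*M⁻¹*K)*(1-q*K)))
      * (-c1*S*M*(1-K/M)*(1-K*q/M)*(1-c2*(K*q))*(1-1/(K*q)))
      = w * ((1-K/P)*(1-c2*c3*P*q*K)*c1*S*M*(1-K/M)/((1-E*K)*K)) := by
  have e2 : 1-K*q/M = 1 - q*M⁻¹*K := by ring
  have e3 : 1-c2*(K*q) = 1 - q*c2*K := by ring
  have e4 : 1-1/(K*q) = -(1-q*K)/(K*q) := by field_simp; ring
  have e5 : 1-P⁻¹*K = 1 - K/P := by ring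
  rw [e2, e3, e4, e5]
  clear e2 e3 e4 e5
  generalize 1 - q*c2*K = d1 at *
  generalize 1 - E*K = d2 at *
  generalize 1 - q*M⁻¹*K = d3 at *
  generalize 1 - q*K = d4 at *
  generalize 1 - K/P = d5 at *
  generalize 1 - K/M = d6 at *
  field_simp

/-- the series part -/
def ser (q c1 c2 c3 : ℂ) (N n : ℕ) (X : ℂ) : ℂ :=
  ∑ k ∈ Finset.range (n+1),
    wt q (q^n)⁻¹ (c2*c3*q^n*q) (q*c2) (c1*c2*c3*(q^N*q^2)) (q^N)⁻¹ k * FF q (c1*c2) X k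

lemma p_eq (q s c1 c2 c3 t2 : ℂ) (hq : q ≠ 0) (N n : ℕ) (x : ℤ) (X : ℂ) (hX : q^x = X)
    (hn : n ≤ N) (hx0 : 0 ≤ x) (hxN : x ≤ N) :
    p q s c1 c2 c3 t2 N n x = Om q s c1 c2 c3 t2 N n * ser q c1 c2 c3 N n X := by
  rw [p, if_pos ⟨by positivity, by exact_mod_cast hn, hx0, hxN⟩, ser]
  congr 1
  rw [Int.toNat_natCast]
  apply Finset.sum_congr rfl
  intro k _
  have e1 : q^(-(n:ℤ)) = (q^n)⁻¹ := by rw [zpow_neg, zpow_natCast]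
  have e2 : c2*c3*q^((n:ℤ)+1) = c2*c3*q^n*q := by
    rw [zpow_add₀ hq, zpow_natCast, zpow_one]; ring
  have e3 : q^(-x) = X⁻¹ := by rw [zpow_neg, hX]
  have e4 : c1*c2*q^(x+1) = c1*c2*q*X := by
    rw [zpow_add₀ hq, hX, zpow_one]; ring
  have e5 : c1*c2*c3*q^((N:ℤ)+2) = c1*c2*c3*(q^N*q^2) := by
    rw [zpow_add₀ hq, zpow_natCast]; rfl
  have e6 : q^(-(N:ℤ)) = (q^N)⁻¹ := by rw [zpow_neg, zpow_natCast]
  rw [e1, e2, e3, e4, e5, e6, wt, FF]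
  ring

lemma Om_ratio (q s c1 c2 c3 t2 : ℂ) (hq : q ≠ 0) (hS : s*t2 ≠ 0) (n d : ℕ)
    (h1 : poch q q n ≠ 0) (h2 : poch q q (d+1) ≠ 0)
    (h3 : poch q (c2*c3*(q^n*q)) (n+d+2) ≠ 0) (h4 : poch q (q*c3) n ≠ 0) :
    Om q s c1 c2 c3 t2 ((n+d+1 : ℕ):ℤ) n *
      ((1-q^(d+1))*(1-c1*c2*c3*(q^(n+d)*q^2))*(1-c2*c3*(q^n*q^(n+d)*q^2)))
     = Om q s c1 c2 c3 t2 ((n+d:ℕ):ℤ) n * ((1-q^(n+d+1))*(1-c1*c2*c3*(q^(n+d)*q^2)*q^n)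
        *(1-c1*q^(d+1)) * (s*t2)) := by
  have t1 : (((n+d+1:ℕ):ℤ) - n).toNat = d+1 := by omega
  have t2' : (((n+d:ℕ):ℤ) - n).toNat = d := by omega
  have t3 : (((n+d+1:ℕ):ℤ) + 1).toNat = n+d+2 := by omega
  have t4 : (((n+d:ℕ):ℤ) + 1).toNat = n+d+1 := by omega
  have z1 : c1*c2*c3*q^(((n+d+1:ℕ):ℤ)+2) = q*(c1*c2*c3*(q^(n+d)*q^2)) := by
    rw [zpow_add₀ hq, zpow_natCast, pow_succ, zpow_ofNat]; ring
  have z2 : c1*c2*c3*q^(((n+d:ℕ):ℤ)+2) = c1*c2*c3*(q^(n+d)*q^2) := by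
    rw [zpow_add₀ hq, zpow_natCast, zpow_ofNat]
  have z3 : q^((n:ℤ)+1) = q^n*q := by rw [zpow_add₀ hq, zpow_natCast, zpow_one]
  have z4 : (s*t2)^(2*(n:ℤ)-((n+d:ℕ):ℤ)) = (s*t2)^(2*(n:ℤ)-((n+d+1:ℕ):ℤ)) * (s*t2) := by
    rw [← zpow_add_one₀ hS]; congr 1; push_cast; ring
  have hz : (s*t2)^(2*(n:ℤ)-((n+d+1:ℕ):ℤ)) ≠ 0 := zpow_ne_zero _ hS
  rw [Om, Om, binom, binom, if_pos (by constructor <;> omega), if_pos (by constructor <;> omega)]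
  rw [t1, t2', t3, t4, z1, z2, z3, z4]
  simp only [Int.toNat_natCast]
  have hsh := poch_shift q (c1*c2*c3*(q^(n+d)*q^2)) n
  generalize (s*t2)^(2*(n:ℤ)-((n+d+1:ℕ):ℤ)) = Z at *
  generalize 1 - c2*c3*q^(2*(n:ℤ)+1) = Y at *
  rw [poch_succ q q (n+d), poch_succ q (q*c1) d, poch_succ q q d]
  rw [poch_succ] at h2
  rw [show n+d+2 = (n+d+1)+1 from rfl, poch_succ] at h3 ⊢
  have g1 := left_ne_zero_of_mul h2
  have g2 := right_ne_zero_of_mul h2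
  have g3 := left_ne_zero_of_mul h3
  have g4 := right_ne_zero_of_mul h3
  rw [show 1 - q*q^d = 1 - q^(d+1) by ring] at g2 ⊢
  rw [show 1 - q*q^(n+d) = 1 - q^(n+d+1) by ring]
  rw [show 1 - q*c1*q^d = 1 - c1*q^(d+1) by ring]
  rw [show 1 - c2*c3*(q^n*q)*q^(n+d+1) = 1 - c2*c3*(q^n*q^(n+d)*q^2) by ring] at g4 ⊢
  generalize s*t2 = S at *
  generalize 1 - c2*c3*(q^n*q^(n+d)*q^2) = y1 at *
  generalize 1 - q^(d+1) = y2 at *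
  generalize 1 - q^(n+d+1) = y3 at *
  generalize 1 - c1*q^(d+1) = y4 at *
  generalize c1*c2*c3*(q^(n+d)*q^2) = E at *
  generalize poch q (q*E) n = y5 at *
  generalize poch q (q*c3) n = y6 at *
  generalize poch q (q*c2) n = y7 at *
  generalize poch q (q*c1) d = y8 at *
  generalize poch q (c2*c3*(q^n*q)) (n+d+1) = y9 at *
  generalize 1 - E*q^n = y10 at *
  generalize 1 - E = y11 at *
  generalize poch q E n = y12 at *
  field_simp
  linear_combination poch q q (n+d) * y3 * Y * y7 * y4 * y8 * hsh

end qR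
namespace qR

lemma vne (q : ℂ) (hq : q ≠ 0) (L : ℕ) (hqn : ∀ j, 1 ≤ j → j ≤ L → 1 - q^j ≠ 0)
    (a b : ℕ) (hab : b < a) (ha : a ≤ L) : 1 - (q^a)⁻¹*q^b ≠ 0 := by
  intro h
  apply hqn (a-b) (by omega) (by omega)
  have h2 : q^a = q^(a-b)*q^b := by rw [← pow_add]; congr 1; omega
  have h3 : q^b ≠ 0 := pow_ne_zero _ hq
  have h4 : q^(a-b) ≠ 0 := pow_ne_zero _ hq
  rw [h2] at h
  field_simp at h
  linear_combination -h

lemma ser_plus (q S c1 c2 c3 X : ℂ) (N n : ℕ) (hn : n ≤ N)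
    (hq : q ≠ 0) (hX : X ≠ 0) (hS : S ≠ 0)
    (hSS : S^2 = q*c2) (hc1 : c1 ≠ 0) (hc2 : c2 ≠ 0)
    (n2 : ∀ j, j ≤ 2*N+5 → 1 - c2*q^j ≠ 0)
    (n123 : ∀ j, j ≤ 2*N+5 → 1 - c1*c2*c3*q^j ≠ 0)
    (hqn : ∀ j, 1 ≤ j → j ≤ N+1 → 1 - q^j ≠ 0)
    (h0 : 1 - c2*c1*X^2 ≠ 0) (h1 : 1 - c2*c1*X^2*q ≠ 0) (h2 : 1 - c2*c1*X^2*q^2 ≠ 0)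
    (Pp P0 Pm : ℂ)
    (hPp : Pp = -S*c2*(X^2/q^N/q)*(1-X)*(1-c3*(q^N*q/X))*(1-c3*(q^N*q^2/X))*(1-c1*X)
      /((1 - c2*c1*X^2)*(1 - c2*c1*X^2*q)))
    (hPm : Pm = -((1-c3*c2*c1*(X*q^N*q^2))*(1-c3*c2*c1*(X*q^N*q^3))*(1-c2*(X*q))*(1-c2*c1*(X*q)))
      /(c1*(q^N*q)*S*(1 - c2*c1*X^2*q)*(1 - c2*c1*X^2*q^2)))
    (hP0 : P0 = -Pp - Pm - (1-c3*c2*(q^N*q^2))*(1-c3*c2*c1*(q^N*q^2))/(c1*(q^N*q)*S)) :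
    Pm * ser q c1 c2 c3 (N+1) n (q*X) + P0 * ser q c1 c2 c3 (N+1) n X
      + Pp * ser q c1 c2 c3 (N+1) n (X/q)
    = -(1-c1*c2*c3*(q^N*q^2))*(1-q^N*q/q^n)*(1-c2*c3*q^n*q^N*q^2)/(c1*q^N*q*(1-q^N*q)*S)
       * ser q c1 c2 c3 N n X := by
  have hop := op_plus q S c1 c2 c3 (q^N) X hq hX (pow_ne_zero _ hq) hS hSS hc1 hc2 h0 h1 h2
    Pp P0 Pm hPp hPm hP0
  have hE' : c1*c2*c3*(q^(N+1)*q^2) = q*(c1*c2*c3*(q^N*q^2)) := by ring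
  have hV' : (q^(N+1))⁻¹ = (q*q^N)⁻¹ := by rw [pow_succ, mul_comm]
  have hqN : q^N ≠ 0 := pow_ne_zero _ hq
  have hqP : q^n ≠ 0 := pow_ne_zero _ hq
  have hv0 : ∀ b, b ≤ N → 1 - (q*q^N)⁻¹*q^b ≠ 0 := fun b hb => by
    rw [← hV']; exact vne q hq (N+1) hqn (N+1) b (by omega) le_rfl
  have he : ∀ b, b ≤ N → 1 - c1*c2*c3*(q^N*q^2)*q^b ≠ 0 := fun b hb => by
    have := n123 (N+2+b) (by omega)
    rwa [show c1*c2*c3*q^(N+2+b) = c1*c2*c3*(q^N*q^2)*q^b by ring] at this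
  have he' : ∀ b, b ≤ N → 1 - q*(c1*c2*c3*(q^N*q^2))*q^b ≠ 0 := fun b hb => by
    have := n123 (N+3+b) (by omega)
    rwa [show c1*c2*c3*q^(N+3+b) = q*(c1*c2*c3*(q^N*q^2))*q^b by ring] at this
  have hv1 : ∀ b, b < N → 1 - (q^N)⁻¹*q^b ≠ 0 := fun b hb =>
    vne q hq (N+1) hqn N b hb (by omega)
  have he0 : 1 - c1*c2*c3*(q^N*q^2) ≠ 0 := by simpa using he 0 (by omega)
  have hMq : 1 - q^N*q ≠ 0 := by rw [← pow_succ]; exact hqn _ (by omega) le_rfl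
  have hqV : q*(q*q^N)⁻¹ = (q^N)⁻¹ := by field_simp
  have key := sum_abs
    (fun k => wt q (q^n)⁻¹ (c2*c3*q^n*q) (q*c2) (q*(c1*c2*c3*(q^N*q^2))) (q*q^N)⁻¹ k)
    (fun k => wt q (q^n)⁻¹ (c2*c3*q^n*q) (q*c2) (c1*c2*c3*(q^N*q^2)) (q^N)⁻¹ k)
    (fun k => -(1-c2*c3*(q^k)*q^N*q^2)*(1-c1*c2*c3*q^N*q^k*q^2)/(c1*q^N*q*S*q^k))
    (fun k => -(1-1/q^k)*(1-c1*c2*c3*q^k*q^N*q)*(1-c1*c2*c3*q^k*q^N*q^2)*(1-c2*q^k)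
          /(c1*q^N*q*S))
    (fun k => (1-q^k/q^n)*(1-c2*c3*q^n*q*q^k)*(1-c1*c2*c3*(q^N*q^2)*q^k)
      /((1-(q*q^N)⁻¹*q^k)*q^k*c1*q^N*q*S))
    (FF q (c1*c2) X)
    (fun k => Pm * FF q (c1*c2) (q*X) k + P0 * FF q (c1*c2) X k + Pp * FF q (c1*c2) (X/q) k)
    (-(1-c1*c2*c3*(q^N*q^2))*(1-q^N*q/q^n)*(1-c2*c3*q^n*q^N*q^2)/(c1*q^N*q*(1-q^N*q)*S))
    n ?_ ?_ ?_ ?_ ?_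
  · simp only [ser, hE', hV']
    rw [← key]
    simp only [Finset.mul_sum]
    rw [← Finset.sum_add_distrib, ← Finset.sum_add_distrib]
    apply Finset.sum_congr rfl
    intro k _
    ring
  · simp only [FF_zero, hP0, pow_zero]
    ring
  · intro k; exact hop k
  · intro k hk
    rw [wt_succ, pow_succ]
    exact coef_plus_r q S c1 c2 c3 (q^N) (q^n) (q^k) _ _ hq hqN hS hc1 hqP
      (pow_ne_zero _ hq) rfl
      (by rw [show q*c2*q^k = c2*q^(k+1) by ring]; exact n2 _ (by omega))
      (he' k (by omega)) (hv0 k (by omega))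
      (by rw [mul_comm, ← pow_succ]; exact hqn _ (by omega) (by omega))
  · simp [div_self hqP]
  · intro k hk
    refine coef_plus_v q S c1 c2 c3 (q^N) (q^n) (q^k) _ _ _ hq hqN hS hc1 hqP
      (pow_ne_zero _ hq) rfl he0 (hv0 k (by omega)) hMq ?_
    have := wt_shift q (q^n)⁻¹ (c2*c3*q^n*q) (q*c2) (c1*c2*c3*(q^N*q^2)) (q*q^N)⁻¹ k he0
      (hv0 k (by omega)) (poch_ne _ _ _ fun l hl => he l (by omega))
      (poch_ne _ _ _ fun l hl => he' l (by omega))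
      (poch_ne _ _ _ fun l hl => hv0 l (by omega))
      (poch_ne _ _ _ fun l hl => by rw [hqV]; exact hv1 l (by omega))
    rwa [hqV] at this

/-- Here the original `N` is `N+1`. -/
lemma ser_minus (q S c1 c2 c3 X : ℂ) (N n : ℕ) (hn : n ≤ N)
    (hq : q ≠ 0) (hX : X ≠ 0)
    (n2 : ∀ j, j ≤ 2*(N+1)+5 → 1 - c2*q^j ≠ 0)
    (n123 : ∀ j, j ≤ 2*(N+1)+5 → 1 - c1*c2*c3*q^j ≠ 0)
    (hqn : ∀ j, 1 ≤ j → j ≤ (N+1)+1 → 1 - q^j ≠ 0)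
    (h0 : 1 - c2*c1*X^2 ≠ 0) (h1 : 1 - c2*c1*X^2*q ≠ 0) (h2 : 1 - c2*c1*X^2*q^2 ≠ 0)
    (Pp P0 Pm : ℂ)
    (hPp : Pp = -S*(1-X)*(1-c1*X)*(1-c2*c1*(X*q^(N+1)))*(1-c2*c1*(X*q^(N+1)*q))
      /(q^(N+1)*(1 - c2*c1*X^2)*(1 - c2*c1*X^2*q)))
    (hPm : Pm = -c1*S*q^(N+1)*(1-X/q^(N+1))*(1-X*q/q^(N+1))*(1-c2*(X*q))*(1-c2*c1*(X*q))
      /((1 - c2*c1*X^2*q)*(1 - c2*c1*X^2*q^2)))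
    (hP0 : P0 = -Pp - Pm - S*(1-c1*q^(N+1))*(1/q^(N+1)-1)) :
    Pm * ser q c1 c2 c3 N n (q*X) + P0 * ser q c1 c2 c3 N n X
      + Pp * ser q c1 c2 c3 N n (X/q)
    = -S*(1-q^(N+1))*(1-c1*c2*c3*(q^(N+1)*q)*q^n)*(1-c1*q^(N+1)/q^n)
        /(q^(N+1)*(1-c1*c2*c3*(q^(N+1)*q)))
       * ser q c1 c2 c3 (N+1) n X := by
  have hop := op_minus q S c1 c2 (q^(N+1)) X hq hX (pow_ne_zero _ hq) h0 h1 h2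
    Pp P0 Pm hPp hPm hP0
  have hE' : c1*c2*c3*(q^N*q^2) = c1*c2*c3*(q^(N+1)*q) := by ring
  have hE2 : c1*c2*c3*(q^(N+1)*q^2) = q*(c1*c2*c3*(q^(N+1)*q)) := by ring
  have hV' : (q^N)⁻¹ = q*(q^(N+1))⁻¹ := by rw [pow_succ]; field_simp
  have hqN : q^(N+1) ≠ 0 := pow_ne_zero _ hq
  have hqP : q^n ≠ 0 := pow_ne_zero _ hq
  have hv0 : ∀ b, b ≤ N → 1 - (q^(N+1))⁻¹*q^b ≠ 0 := fun b hb => by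
    exact vne q hq (N+1+1) hqn (N+1) b (by omega) (by omega)
  have he : ∀ b, b ≤ N → 1 - c1*c2*c3*(q^(N+1)*q)*q^b ≠ 0 := fun b hb => by
    have := n123 (N+2+b) (by omega)
    rwa [show c1*c2*c3*q^(N+2+b) = c1*c2*c3*(q^(N+1)*q)*q^b by ring] at this
  have he' : ∀ b, b ≤ N → 1 - q*(c1*c2*c3*(q^(N+1)*q))*q^b ≠ 0 := fun b hb => by
    have := n123 (N+3+b) (by omega)
    rwa [show c1*c2*c3*q^(N+3+b) = q*(c1*c2*c3*(q^(N+1)*q))*q^b by ring] at this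
  have hv1 : ∀ b, b < N → 1 - q*(q^(N+1))⁻¹*q^b ≠ 0 := fun b hb => by
    rw [← hV']
    exact vne q hq (N+1+1) hqn N b hb (by omega)
  have he0 : 1 - c1*c2*c3*(q^(N+1)*q) ≠ 0 := by simpa using he 0 (by omega)
  have hM1 : 1 - q^(N+1) ≠ 0 := hqn _ (by omega) (by omega)
  have key := sum_abs
    (fun k => wt q (q^n)⁻¹ (c2*c3*q^n*q) (q*c2) (c1*c2*c3*(q^(N+1)*q)) (q*(q^(N+1))⁻¹) k)
    (fun k => wt q (q^n)⁻¹ (c2*c3*q^n*q) (q*c2) (q*(c1*c2*c3*(q^(N+1)*q))) (q^(N+1))⁻¹ k)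
    (fun k => S*(1-c1*q^(N+1)/q^k)*(1-q^k/q^(N+1)))
    (fun k => -c1*S*q^(N+1)*(1-q^(k-1)/q^(N+1))*(1-q^k/q^(N+1))*(1-c2*q^k)*(1-1/q^k))
    (fun k => (1-q^k/q^n)*(1-c2*c3*q^n*q*q^k)*c1*S*q^(N+1)*(1-q^k/q^(N+1))
        /((1-c1*c2*c3*(q^(N+1)*q)*q^k)*q^k))
    (FF q (c1*c2) X)
    (fun k => Pm * FF q (c1*c2) (q*X) k + P0 * FF q (c1*c2) X k + Pp * FF q (c1*c2) (X/q) k)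
    (-S*(1-q^(N+1))*(1-c1*c2*c3*(q^(N+1)*q)*q^n)*(1-c1*q^(N+1)/q^n)
        /(q^(N+1)*(1-c1*c2*c3*(q^(N+1)*q))))
    n ?_ ?_ ?_ ?_ ?_
  · simp only [ser, hE', hE2, hV']
    rw [← key]
    simp only [Finset.mul_sum]
    rw [← Finset.sum_add_distrib, ← Finset.sum_add_distrib]
    apply Finset.sum_congr rfl
    intro k _
    ring
  · simp only [FF_zero, hP0, pow_zero]
    ring
  · intro k; exact hop k
  · intro k hk
    simp only [Nat.add_sub_cancel]
    rw [wt_succ, pow_succ q k]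
    exact coef_minus_r q S c1 c2 c3 (q^(N+1)) (q^n) (q^k) _ _ hq hqN
      (pow_ne_zero _ hq)
      (by rw [show q*c2*q^k = c2*q^(k+1) by ring]; exact n2 _ (by omega))
      (he k (by omega)) (hv1 k (by omega))
      (by rw [mul_comm, ← pow_succ]; exact hqn _ (by omega) (by omega))
  · simp [div_self hqP]
  · intro k hk
    refine coef_minus_v q S c1 c2 c3 (q^(N+1)) (q^n) (q^k) _ _ _ hqN hqP
      (pow_ne_zero _ hq) rfl he0 (he k (by omega)) hM1 ?_
    exact wt_shift q (q^n)⁻¹ (c2*c3*q^n*q) (q*c2) (c1*c2*c3*(q^(N+1)*q)) (q^(N+1))⁻¹ k he0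
      (hv0 k (by omega)) (poch_ne _ _ _ fun l hl => he l (by omega))
      (poch_ne _ _ _ fun l hl => he' l (by omega))
      (poch_ne _ _ _ fun l hl => hv0 l (by omega))
      (poch_ne _ _ _ fun l hl => hv1 l (by omega))

end qR
namespace qR

lemma lam_Om_plus (q s c1 c2 c3 t2 : ℂ) (N n : ℕ) (hn : n ≤ N) (hq : q ≠ 0) (hS : s*t2 ≠ 0)
    (hc1 : c1 ≠ 0)
    (n3 : ∀ j, j ≤ 2*N+5 → 1 - c3*q^j ≠ 0)
    (n23 : ∀ j, j ≤ 2*N+5 → 1 - c2*c3*q^j ≠ 0)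
    (hqn : ∀ j, 1 ≤ j → j ≤ N+1 → 1 - q^j ≠ 0) :
    lamP q c3 c2 c1 N n * Om q s c1 c2 c3 t2 N n
    = Om q s c1 c2 c3 t2 ((N+1:ℕ):ℤ) n *
      (-(1-c1*c2*c3*(q^N*q^2))*(1-q^N*q/q^n)*(1-c2*c3*q^n*q^N*q^2)
        /(c1*q^N*q*(1-q^N*q)*(s*t2))) := by
  obtain ⟨d, rfl⟩ := Nat.exists_eq_add_of_le hn
  have hr := Om_ratio q s c1 c2 c3 t2 hq hS n d
    (poch_ne _ _ _ fun l hl => by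
      rw [mul_comm, ← pow_succ]; exact hqn _ (by omega) (by omega))
    (poch_ne _ _ _ fun l hl => by
      rw [mul_comm, ← pow_succ]; exact hqn _ (by omega) (by omega))
    (poch_ne _ _ _ fun l hl => by
      rw [show c2*c3*(q^n*q)*q^l = c2*c3*q^(n+1+l) by ring]; exact n23 _ (by omega))
    (poch_ne _ _ _ fun l hl => by
      rw [show q*c3*q^l = c3*q^(1+l) by ring]; exact n3 _ (by omega))
  have hP : q^n ≠ 0 := pow_ne_zero _ hq
  have hM : q^(n+d) ≠ 0 := pow_ne_zero _ hq
  have hMq : 1 - q^(n+d)*q ≠ 0 := by rw [← pow_succ]; exact hqn _ (by omega) le_rfl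
  have e1 : lamP q c3 c2 c1 ((n+d:ℕ):ℤ) n
      = -(1-c1*q^(d+1))*(1-c1*c2*c3*(q^(n+d)*q^2)*q^n)/(c1*q^(n+d)*q) := by
    rw [lamP]
    have z1 : q^(-((n+d:ℕ):ℤ)-1) = (q^(n+d)*q)⁻¹ := by
      rw [← pow_succ, ← zpow_natCast, ← zpow_neg]; congr 1; push_cast; ring
    have z2 : q^(-(n:ℤ)) = (q^n)⁻¹ := by rw [zpow_neg, zpow_natCast]
    have z3 : q^(((n+d:ℕ):ℤ)+n+2) = q^(n+d)*q^2*q^n := by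
      rw [zpow_add₀ hq, zpow_add₀ hq, zpow_natCast, zpow_natCast, zpow_ofNat]; ring
    rw [z1, z2, z3, pow_add, pow_succ]
    field_simp
    ring
  have e2 : 1 - q^(n+d)*q/q^n = 1 - q^(d+1) := by
    rw [pow_add, pow_succ]; field_simp
  rw [e1, e2]
  rw [show 1 - q^(n+d+1) = 1 - q^(n+d)*q by rw [pow_succ]] at hr
  rw [show 1 - c2*c3*q^n*q^(n+d)*q^2 = 1 - c2*c3*(q^n*q^(n+d)*q^2) by ring]
  generalize Om q s c1 c2 c3 t2 ((n+d+1:ℕ):ℤ) n = O1 at *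
  generalize Om q s c1 c2 c3 t2 ((n+d:ℕ):ℤ) n = O0 at *
  generalize 1 - q^(n+d)*q = y1 at *
  generalize s*t2 = S at *
  field_simp
  linear_combination hr

lemma lam_Om_minus (q s c1 c2 c3 t2 : ℂ) (N n : ℕ) (hn : n ≤ N) (hq : q ≠ 0) (hS : s*t2 ≠ 0)
    (n3 : ∀ j, j ≤ 2*(N+1)+5 → 1 - c3*q^j ≠ 0)
    (n23 : ∀ j, j ≤ 2*(N+1)+5 → 1 - c2*c3*q^j ≠ 0)
    (n123 : ∀ j, j ≤ 2*(N+1)+5 → 1 - c1*c2*c3*q^j ≠ 0)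
    (hqn : ∀ j, 1 ≤ j → j ≤ (N+1)+1 → 1 - q^j ≠ 0) :
    lamM q c3 c2 c1 ((N+1:ℕ):ℤ) n * Om q s c1 c2 c3 t2 ((N+1:ℕ):ℤ) n
    = Om q s c1 c2 c3 t2 N n *
      (-(s*t2)*(1-q^(N+1))*(1-c1*c2*c3*(q^(N+1)*q)*q^n)*(1-c1*q^(N+1)/q^n)
        /(q^(N+1)*(1-c1*c2*c3*(q^(N+1)*q)))) := by
  obtain ⟨d, rfl⟩ := Nat.exists_eq_add_of_le hn
  have hr := Om_ratio q s c1 c2 c3 t2 hq hS n d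
    (poch_ne _ _ _ fun l hl => by
      rw [mul_comm, ← pow_succ]; exact hqn _ (by omega) (by omega))
    (poch_ne _ _ _ fun l hl => by
      rw [mul_comm, ← pow_succ]; exact hqn _ (by omega) (by omega))
    (poch_ne _ _ _ fun l hl => by
      rw [show c2*c3*(q^n*q)*q^l = c2*c3*q^(n+1+l) by ring]; exact n23 _ (by omega))
    (poch_ne _ _ _ fun l hl => by
      rw [show q*c3*q^l = c3*q^(1+l) by ring]; exact n3 _ (by omega))
  have hP : q^n ≠ 0 := pow_ne_zero _ hq
  have hM : q^(n+d+1) ≠ 0 := pow_ne_zero _ hq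
  have hE : c1*c2*c3*(q^(n+d)*q^2) = c1*c2*c3*(q^(n+d+1)*q) := by ring
  have hE1 : 1 - c1*c2*c3*(q^(n+d+1)*q) ≠ 0 := by
    rw [← pow_succ]; exact n123 _ (by omega)
  have e1 : lamM q c3 c2 c1 ((n+d+1:ℕ):ℤ) n
      = -(1-q^(d+1))*(1-c2*c3*(q^n*q^(n+d)*q^2))/q^(n+d+1) := by
    rw [lamM]
    have z1 : q^(-((n+d+1:ℕ):ℤ)) = (q^(n+d+1))⁻¹ := by rw [zpow_neg, zpow_natCast]
    have z2 : q^(-(n:ℤ)) = (q^n)⁻¹ := by rw [zpow_neg, zpow_natCast]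
    have z3 : q^(((n+d+1:ℕ):ℤ)+n+1) = q^n*q^(n+d)*q^2 := by
      rw [zpow_add₀ hq, zpow_add₀ hq, zpow_natCast, zpow_natCast, zpow_one]; ring
    rw [z1, z2, z3, show n+d+1 = n+(d+1) from rfl, pow_add q n (d+1), pow_succ]
    field_simp
  have e2 : q^(n+d+1)/q^n = q^(d+1) := by
    rw [show n+d+1 = n+(d+1) from rfl, pow_add q n (d+1)]; field_simp
  rw [e1, mul_div_assoc c1, e2]
  rw [hE] at hr
  generalize Om q s c1 c2 c3 t2 ((n+d+1:ℕ):ℤ) n = O1 at *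
  generalize Om q s c1 c2 c3 t2 ((n+d:ℕ):ℤ) n = O0 at *
  generalize 1 - c1*c2*c3*(q^(n+d+1)*q) = y1 at *
  field_simp
  linear_combination -hr

end qR


/-- Contiguity difference relations for the normalized q-Racah polynomials
(the first conjunct is the plus sign, the second the minus sign). -/
theorem qRacah_contiguity_difference
    (N : ℕ) (q s c1 c2 c3 t1 t2 t3 : ℂ)
    (hq : q ≠ 0) (hc1 : c1 ≠ 0) (hc2 : c2 ≠ 0) (hc3 : c3 ≠ 0)
    (hs : s ^ 2 = q) (ht1 : t1 ^ 2 = c1) (ht2 : t2 ^ 2 = c2) (ht3 : t3 ^ 2 = c3)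
    (hgen : ∀ e1 e2 e3 : ℕ, e1 ≤ 1 → e2 ≤ 1 → e3 ≤ 1 → 1 ≤ e1 + e2 + e3 →
      ∀ k : ℤ, 0 ≤ k → k ≤ 2 * (N : ℤ) + 5 → c1 ^ e1 * c2 ^ e2 * c3 ^ e3 ≠ q ^ (-k))
    (hq1 : ∀ k : ℕ, 1 ≤ k → k ≤ N + 1 → q ^ k ≠ 1)
    (n x : ℤ) (hn0 : 0 ≤ n) (hnN : n ≤ (N : ℤ)) (hx0 : 0 ≤ x) (hxN : x ≤ (N : ℤ)) :
    (qR.lamP q c3 c2 c1 (N : ℤ) n * qR.p q s c1 c2 c3 t2 (N : ℤ) n x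
        = ∑ ε ∈ ({-1, 0, 1} : Finset ℤ),
            qR.PhiC q (s * t2) c3 c2 c1 1 ε (N : ℤ) x
              * qR.p q s c1 c2 c3 t2 ((N : ℤ) + 1) n (x - ε))
    ∧
    (qR.lamM q c3 c2 c1 (N : ℤ) n * qR.p q s c1 c2 c3 t2 (N : ℤ) n x
        = ∑ ε ∈ ({-1, 0, 1} : Finset ℤ),
            qR.PhiC q (s * t2) c3 c2 c1 (-1) ε (N : ℤ) x
              * qR.p q s c1 c2 c3 t2 ((N : ℤ) - 1) n (x - ε)) := by
  have hs0 : s ≠ 0 := by rintro rfl; apply hq; rw [← hs]; simp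
  have ht0 : t2 ≠ 0 := by rintro rfl; apply hc2; rw [← ht2]; simp
  have hS : s*t2 ≠ 0 := mul_ne_zero hs0 ht0
  have hSS : (s*t2)^2 = q*c2 := by rw [mul_pow, hs, ht2]
  have hne : ∀ c : ℂ, (∀ k : ℤ, 0 ≤ k → k ≤ 2 * (N : ℤ) + 5 → c ≠ q ^ (-k)) →
      ∀ j : ℕ, j ≤ 2*N+5 → 1 - c*q^j ≠ 0 := by
    intro c hc j hj h
    apply hc j (by positivity) (by exact_mod_cast hj)
    rw [zpow_neg, zpow_natCast]
    exact eq_inv_of_mul_eq_one_left (by linear_combination -h)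
  have n2 := hne c2 (by simpa using hgen 0 1 0 (by simp) (by simp) (by simp) (by simp))
  have n3 := hne c3 (by simpa using hgen 0 0 1 (by simp) (by simp) (by simp) (by simp))
  have n12 := hne (c1*c2) (by simpa using hgen 1 1 0 (by simp) (by simp) (by simp) (by simp))
  have n23 := hne (c2*c3) (by simpa using hgen 0 1 1 (by simp) (by simp) (by simp) (by simp))
  have n123 := hne (c1*c2*c3) (by simpa using hgen 1 1 1 (by simp) (by simp) (by simp) (by simp))
  have hqn : ∀ j, 1 ≤ j → j ≤ N+1 → 1 - q^j ≠ 0 := fun j h1 h2 h =>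
    hq1 j h1 h2 (by linear_combination -h)
  clear hgen hne hq1
  lift n to ℕ using hn0
  lift x to ℕ using hx0
  have hn : n ≤ N := by exact_mod_cast hnN
  have hx : x ≤ N := by exact_mod_cast hxN
  have hX : q^x ≠ 0 := pow_ne_zero _ hq
  have hM : q^N ≠ 0 := pow_ne_zero _ hq
  have h0 : 1 - c2*c1*(q^x)^2 ≠ 0 := by
    rw [show c2*c1*(q^x)^2 = c1*c2*q^(2*x) by ring]; exact n12 _ (by omega)
  have h1 : 1 - c2*c1*(q^x)^2*q ≠ 0 := by
    rw [show c2*c1*(q^x)^2*q = c1*c2*q^(2*x+1) by ring]; exact n12 _ (by omega)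
  have h2 : 1 - c2*c1*(q^x)^2*q^2 ≠ 0 := by
    rw [show c2*c1*(q^x)^2*q^2 = c1*c2*q^(2*x+2) by ring]; exact n12 _ (by omega)
  have zx2 : q^(2*(x:ℤ)) = (q^x)^2 := by
    rw [← zpow_natCast q x, two_mul, zpow_add₀ hq]; ring
  have xp : q^((x:ℤ)+1) = q*q^x := by rw [zpow_add₀ hq, zpow_natCast, zpow_one, mul_comm]
  have xm : q^((x:ℤ)-1) = q^x/q := by rw [zpow_sub₀ hq, zpow_natCast, zpow_one]
  have x0 : q^(x:ℤ) = q^x := zpow_natCast _ _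
  have z3 : q^(3:ℤ) = q^3 := zpow_ofNat _ _
  have z2 : q^(2:ℤ) = q^2 := zpow_ofNat _ _
  have hsum : ∀ f : ℤ → ℂ, ∑ ε ∈ ({-1, 0, 1} : Finset ℤ), f ε = f (-1) + f 0 + f 1 := by
    intro f
    rw [Finset.sum_insert (by decide), Finset.sum_insert (by decide), Finset.sum_singleton]
    ring
  constructor
  · rw [hsum]
    simp only [qR.PhiC, if_true, if_neg (show ¬((-1:ℤ) = 1) by decide),
      if_neg (show ¬((0:ℤ) = 1) by decide), if_neg (show ¬((0:ℤ) = -1) by decide),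
      sub_neg_eq_add, sub_zero]
    have hPp : qR.PhiPp q (s*t2) c3 c2 c1 N x = -(s*t2)*c2*((q^x)^2/q^N/q)*(1-q^x)
        *(1-c3*(q^N*q/q^x))*(1-c3*(q^N*q^2/q^x))*(1-c1*q^x)
        /((1 - c2*c1*(q^x)^2)*(1 - c2*c1*(q^x)^2*q)) := by
      simp only [qR.PhiPp, zpow_add₀ hq, zpow_sub₀ hq, zpow_natCast, zpow_one, zx2, z2]
      ring
    have hPm : qR.PhiPm q (s*t2) c3 c2 c1 N x = -((1-c3*c2*c1*(q^x*q^N*q^2))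
        *(1-c3*c2*c1*(q^x*q^N*q^3))*(1-c2*(q^x*q))*(1-c2*c1*(q^x*q)))
        /(c1*(q^N*q)*(s*t2)*(1 - c2*c1*(q^x)^2*q)*(1 - c2*c1*(q^x)^2*q^2)) := by
      simp only [qR.PhiPm, zpow_add₀ hq, zpow_natCast, zpow_one, zx2, z2, z3]
      ring
    have hP0 : qR.PhiP0 q (s*t2) c3 c2 c1 N x = -qR.PhiPp q (s*t2) c3 c2 c1 N x
        - qR.PhiPm q (s*t2) c3 c2 c1 N x
        - (1-c3*c2*(q^N*q^2))*(1-c3*c2*c1*(q^N*q^2))/(c1*(q^N*q)*(s*t2)) := by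
      simp only [qR.PhiP0, zpow_add₀ hq, zpow_natCast, zpow_one, z2]
    have key := qR.ser_plus q (s*t2) c1 c2 c3 (q^x) N n hn hq hX hS hSS hc1 hc2 n2 n123 hqn
      h0 h1 h2 _ _ _ hPp hPm hP0
    have hlam := qR.lam_Om_plus q s c1 c2 c3 t2 N n hn hq hS hc1 n3 n23 hqn
    rw [show (N:ℤ)+1 = ((N+1:ℕ):ℤ) by push_cast; rfl]
    rw [qR.p_eq q s c1 c2 c3 t2 hq N n x _ x0 hn (by positivity) hxN,
      qR.p_eq q s c1 c2 c3 t2 hq (N+1) n x _ x0 (by omega) (by positivity) (by push_cast; omega),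
      qR.p_eq q s c1 c2 c3 t2 hq (N+1) n (x+1) _ xp (by omega) (by positivity)
        (by push_cast; omega)]
    have hd : qR.PhiPp q (s*t2) c3 c2 c1 N x * qR.p q s c1 c2 c3 t2 ((N+1:ℕ):ℤ) n (x-1)
        = qR.PhiPp q (s*t2) c3 c2 c1 N x * (qR.Om q s c1 c2 c3 t2 ((N+1:ℕ):ℤ) n
          * qR.ser q c1 c2 c3 (N+1) n (q^x/q)) := by
      rcases Nat.eq_zero_or_pos x with hx0 | hx0
      · have : qR.PhiPp q (s*t2) c3 c2 c1 N x = 0 := by rw [hPp, hx0]; simp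
        rw [this]; ring
      · rw [qR.p_eq q s c1 c2 c3 t2 hq (N+1) n (x-1) _ xm (by omega) (by omega)
          (by push_cast; omega)]
    rw [hd, ← mul_assoc, hlam]
    linear_combination -qR.Om q s c1 c2 c3 t2 ((N+1:ℕ):ℤ) n * key
  · rw [hsum]
    simp only [qR.PhiC, if_true, if_neg (show ¬((-1:ℤ) = 1) by decide),
      if_neg (show ¬((0:ℤ) = 1) by decide), if_neg (show ¬((0:ℤ) = -1) by decide),
      sub_neg_eq_add, sub_zero]
    rcases Nat.eq_or_lt_of_le hn with hnN' | hnN'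
    · have hl : qR.lamM q c3 c2 c1 N n = 0 := by rw [qR.lamM, hnN']; simp
      have hp : ∀ y, qR.p q s c1 c2 c3 t2 ((N:ℤ)-1) n y = 0 := by
        intro y
        rw [qR.p, if_neg]
        rintro ⟨-, h, -⟩
        omega
      rw [hl, hp, hp, hp]; ring
    obtain ⟨m, rfl⟩ : ∃ m, N = m+1 := ⟨N-1, by omega⟩
    have hnm : n ≤ m := by omega
    have hPp : qR.PhiMp q (s*t2) c3 c2 c1 ((m+1:ℕ):ℤ) x = -(s*t2)*(1-q^x)*(1-c1*q^x)
        *(1-c2*c1*(q^x*q^(m+1)))*(1-c2*c1*(q^x*q^(m+1)*q))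
        /(q^(m+1)*(1 - c2*c1*(q^x)^2)*(1 - c2*c1*(q^x)^2*q)) := by
      rw [qR.PhiMp, zpow_add₀ hq (x:ℤ), zpow_add₀ hq (_+_) 1, zpow_add₀ hq (x:ℤ),
        zpow_add₀ hq (2*(x:ℤ)), zpow_natCast, zpow_natCast, zpow_one, zx2]
      ring
    have hPm : qR.PhiMm q (s*t2) c3 c2 c1 ((m+1:ℕ):ℤ) x = -c1*(s*t2)*q^(m+1)*(1-q^x/q^(m+1))
        *(1-q^x*q/q^(m+1))*(1-c2*(q^x*q))*(1-c2*c1*(q^x*q))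
        /((1 - c2*c1*(q^x)^2*q)*(1 - c2*c1*(q^x)^2*q^2)) := by
      rw [qR.PhiMm, zpow_add₀ hq (_-_) 1, zpow_sub₀ hq, zpow_add₀ hq (x:ℤ) 1,
        zpow_add₀ hq (2*(x:ℤ)), zpow_add₀ hq (2*(x:ℤ)) 2, zpow_natCast, zpow_natCast, zpow_one,
        zx2, z2]
      ring
    have hP0 : qR.PhiM0 q (s*t2) c3 c2 c1 ((m+1:ℕ):ℤ) x
        = -qR.PhiMp q (s*t2) c3 c2 c1 ((m+1:ℕ):ℤ) x
        - qR.PhiMm q (s*t2) c3 c2 c1 ((m+1:ℕ):ℤ) x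
        - (s*t2)*(1-c1*q^(m+1))*(1/q^(m+1)-1) := by
      rw [qR.PhiM0, zpow_neg, zpow_natCast, one_div]
    have key := qR.ser_minus q (s*t2) c1 c2 c3 (q^x) m n hnm hq hX n2 n123 hqn
      h0 h1 h2 _ _ _ hPp hPm hP0
    have hlam := qR.lam_Om_minus q s c1 c2 c3 t2 m n hnm hq hS n3 n23 n123 hqn
    have hd : qR.PhiMp q (s*t2) c3 c2 c1 ((m+1:ℕ):ℤ) x * qR.p q s c1 c2 c3 t2 (m:ℤ) n (x-1)
        = qR.PhiMp q (s*t2) c3 c2 c1 ((m+1:ℕ):ℤ) x * (qR.Om q s c1 c2 c3 t2 (m:ℤ) n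
          * qR.ser q c1 c2 c3 m n (q^x/q)) := by
      rcases Nat.eq_zero_or_pos x with hx0 | hx0
      · have : qR.PhiMp q (s*t2) c3 c2 c1 ((m+1:ℕ):ℤ) x = 0 := by rw [hPp, hx0]; simp
        rw [this]; ring
      · rw [qR.p_eq q s c1 c2 c3 t2 hq m n (x-1) _ xm hnm (by omega) (by omega)]
    have hz : qR.PhiM0 q (s*t2) c3 c2 c1 ((m+1:ℕ):ℤ) x * qR.p q s c1 c2 c3 t2 (m:ℤ) n x
        = qR.PhiM0 q (s*t2) c3 c2 c1 ((m+1:ℕ):ℤ) x * (qR.Om q s c1 c2 c3 t2 (m:ℤ) n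
          * qR.ser q c1 c2 c3 m n (q^x)) := by
      rcases Nat.eq_or_lt_of_le hx with hx1 | hx1
      · have : qR.PhiM0 q (s*t2) c3 c2 c1 ((m+1:ℕ):ℤ) x = 0 := by
          rw [hP0, hPp, hPm, ← hx1]
          rw [show c2*c1*(q^x*q^x) = c2*c1*(q^x)^2 by ring,
            show c2*c1*(q^x*q^x*q) = c2*c1*(q^x)^2*q by ring, div_self hX]
          generalize 1 - c2*c1*(q^x)^2 = D0 at *
          generalize 1 - c2*c1*(q^x)^2*q = D1 at *
          field_simp
          ring
        rw [this]; ring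
      · rw [qR.p_eq q s c1 c2 c3 t2 hq m n x _ x0 hnm (by omega) (by omega)]
    have hu : qR.PhiMm q (s*t2) c3 c2 c1 ((m+1:ℕ):ℤ) x * qR.p q s c1 c2 c3 t2 (m:ℤ) n (x+1)
        = qR.PhiMm q (s*t2) c3 c2 c1 ((m+1:ℕ):ℤ) x * (qR.Om q s c1 c2 c3 t2 (m:ℤ) n
          * qR.ser q c1 c2 c3 m n (q*q^x)) := by
      by_cases hx1 : x + 1 ≤ m
      · rw [qR.p_eq q s c1 c2 c3 t2 hq m n (x+1) _ xp hnm (by omega) (by omega)]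
      · have : qR.PhiMm q (s*t2) c3 c2 c1 ((m+1:ℕ):ℤ) x = 0 := by
          rw [hPm]
          rcases (show x = m + 1 ∨ x = m by omega) with h | h
          · rw [h, div_self hM]; simp
          · rw [h, ← pow_succ, div_self hM]; simp
        rw [this]; ring
    rw [show ((m+1:ℕ):ℤ)-1 = (m:ℤ) by push_cast; ring, hd, hz, hu,
      qR.p_eq q s c1 c2 c3 t2 hq (m+1) n x _ x0 (by omega) (by positivity) hxN,
      ← mul_assoc, hlam]
    linear_combination -qR.Om q s c1 c2 c3 t2 (m:ℤ) n * key
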